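/- Let $E\subset\mathbb{R}^n$ be a weakly porous set with constants $0<c,\delta<1$. Then there exist $0<\alpha<1$ and $C$, depending only on $n,c,\delta$, such that $\operatorname{dist}(\cdot,E)^{-\alpha}\in A_1(\mathbb{R}^n)$ with $[\operatorname{dist}(\cdot,E)^{-\alpha}]_{A_1}\le C$. -/

import Mathlib

open MeasureTheory Metric Set

noncomputable section

/-- An axis-parallel half-open cube in `ℝⁿ`, given by its lower corner and side length. -/
structure Cube (n : ℕ) where
  a : EuclideanSpace ℝ (Fin n)
  l : ℝ
  pos : 0 < l

/-- The set of points of a cube. -/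
def Cube.set {n : ℕ} (P : Cube n) : Set (EuclideanSpace ℝ (Fin n)) :=
  {x | ∀ i, P.a i ≤ x i ∧ x i < P.a i + P.l}

/-- A weight: locally integrable and a.e. positive. -/
def IsWeight {n : ℕ} (w : EuclideanSpace ℝ (Fin n) → ℝ) : Prop :=
  LocallyIntegrable w volume ∧ ∀ᵐ x ∂(volume : Measure (EuclideanSpace ℝ (Fin n))), 0 < w x

/-- The `A₁` inequality with constant `C`, over all axis-parallel cubes. -/
def A1With {n : ℕ} (w : EuclideanSpace ℝ (Fin n) → ℝ) (C : ℝ) : Prop :=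
  ∀ P : Cube n, (⨍ x in P.set, w x) ≤ C * essInf w (volume.restrict P.set)

/-- Membership in the Muckenhoupt class `A₁`. -/
def MemA1 {n : ℕ} (w : EuclideanSpace ℝ (Fin n) → ℝ) : Prop :=
  IsWeight w ∧ ∃ C : ℝ, A1With w C

/-- The `A_p` inequality with constant `C`, over all axis-parallel cubes. -/
def ApWith {n : ℕ} (w : EuclideanSpace ℝ (Fin n) → ℝ) (p C : ℝ) : Prop :=
  ∀ P : Cube n,
    (⨍ x in P.set, w x) * (⨍ x in P.set, w x ^ (1 / (1 - p))) ^ (p - 1) ≤ C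

/-- Membership in the Muckenhoupt class `A_p`. -/
def MemAp {n : ℕ} (w : EuclideanSpace ℝ (Fin n) → ℝ) (p : ℝ) : Prop :=
  IsWeight w ∧ ∃ C : ℝ, ApWith w p C

/-- `Q` is a dyadic subcube of `P`. -/
def IsDyadicSubcube {n : ℕ} (P Q : Cube n) : Prop :=
  ∃ (j : ℕ) (k : Fin n → ℕ), (∀ i, k i < 2 ^ j) ∧
    Q.l = P.l / 2 ^ j ∧ ∀ i, Q.a i = P.a i + P.l * k i / 2 ^ j

/-- A cube is `E`-free if it does not meet `E`. -/
def EFree {n : ℕ} (E : Set (EuclideanSpace ℝ (Fin n))) (Q : Cube n) : Prop :=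
  Q.set ∩ E = ∅

/-- The measure `|𝓜(P)|` of a largest `E`-free dyadic subcube of `P`
(`0` if there is none). -/
def maxFree {n : ℕ} (E : Set (EuclideanSpace ℝ (Fin n))) (P : Cube n) : ℝ :=
  sSup {v : ℝ | ∃ Q : Cube n, IsDyadicSubcube P Q ∧ EFree E Q ∧ v = (volume Q.set).toReal}

/-- Weak porosity with constants `c`, `δ`. -/
def WeaklyPorousWith {n : ℕ} (E : Set (EuclideanSpace ℝ (Fin n))) (c δ : ℝ) : Prop :=
  ∀ P : Cube n, ∃ (N : ℕ) (Q : Fin N → Cube n),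
    (∀ k, IsDyadicSubcube P (Q k) ∧ EFree E (Q k)) ∧
    (∀ k m, k ≠ m → Disjoint (Q k).set (Q m).set) ∧
    (∀ k, δ * maxFree E P ≤ (volume (Q k).set).toReal) ∧
    c * (volume P.set).toReal ≤ ∑ k, (volume (Q k).set).toReal

/-- A set is weakly porous if it is weakly porous with some constants `0 < c, δ < 1`. -/
def WeaklyPorous {n : ℕ} (E : Set (EuclideanSpace ℝ (Fin n))) : Prop :=
  ∃ c δ : ℝ, 0 < c ∧ c < 1 ∧ 0 < δ ∧ δ < 1 ∧ WeaklyPorousWith E c δ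

/-- Porosity. -/
def Porous {n : ℕ} (E : Set (EuclideanSpace ℝ (Fin n))) : Prop :=
  ∃ c : ℝ, 0 < c ∧ ∀ (x : EuclideanSpace ℝ (Fin n)) (r : ℝ), 0 < r →
    ∃ y : EuclideanSpace ℝ (Fin n), ball y (c * r) ⊆ ball x r \ E

/-- The distance weight `dist(·,E)^{-α}`. -/
def distw {n : ℕ} (E : Set (EuclideanSpace ℝ (Fin n))) (α : ℝ)
    (x : EuclideanSpace ℝ (Fin n)) : ℝ :=
  infDist x E ^ (-α)

/-- `h_E(B(x,R))`: the supremum of radii `t` of balls contained in `B(x,R) \ E`. -/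
def hFree {n : ℕ} (E : Set (EuclideanSpace ℝ (Fin n))) (x : EuclideanSpace ℝ (Fin n))
    (R : ℝ) : ℝ :=
  sSup {t : ℝ | ∃ y ∈ ball x R, ball y t ⊆ ball x R \ E}

/-- The set of admissible exponents in the definition of the Muckenhoupt exponent. -/
def MuckSet {n : ℕ} (E : Set (EuclideanSpace ℝ (Fin n))) : Set ℝ :=
  {α : ℝ | ∃ C : ℝ, ∀ x ∈ E, ∀ R r : ℝ, 0 < r → r < hFree E x R → hFree E x R ≤ R →
    (volume (thickening r E ∩ ball x R)).toReal ≤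
      C * (hFree E x R / r) ^ (-α) * (volume (ball x R)).toReal}

open scoped Classical in
/-- The Muckenhoupt exponent of `E`. -/
def MuckExp {n : ℕ} (E : Set (EuclideanSpace ℝ (Fin n))) : ℝ :=
  if ∀ x ∈ E, ∀ R : ℝ, 0 < R → 0 < hFree E x R then sSup (MuckSet E) else 0

end

namespace Cube

variable {n : ℕ} {E : Set (EuclideanSpace ℝ (Fin n))}

/-- Containment of the closed cubes spanned by `Q` and `P`, in terms of the corners. -/
def Sub (Q P : Cube n) : Prop :=
  ∀ i, P.a i ≤ Q.a i ∧ Q.a i + Q.l ≤ P.a i + P.l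

lemma Sub.trans {P Q R : Cube n} (h₁ : P.Sub Q) (h₂ : Q.Sub R) : P.Sub R :=
  fun i => ⟨(h₂ i).1.trans (h₁ i).1, (h₁ i).2.trans (h₂ i).2⟩

lemma Sub.set_subset {P Q : Cube n} (h : Q.Sub P) : Q.set ⊆ P.set :=
  fun _ hx i => ⟨(h i).1.trans (hx i).1, (hx i).2.trans_le (h i).2⟩

lemma Sub.l_le [NeZero n] {P Q : Cube n} (h : Q.Sub P) : Q.l ≤ P.l := by
  have := h 0
  linarith [this.1, this.2]

lemma set_eq_preimage (P : Cube n) :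
    P.set = (MeasurableEquiv.toLp 2 (Fin n → ℝ)).symm ⁻¹'
      (Set.univ.pi fun i => Set.Ico (P.a i) (P.a i + P.l)) := by
  ext x
  simp [Cube.set]

lemma measurableSet_set (P : Cube n) : MeasurableSet P.set := by
  rw [set_eq_preimage]
  exact (MeasurableEquiv.toLp 2 (Fin n → ℝ)).symm.measurable
    (MeasurableSet.univ_pi fun i => measurableSet_Ico)

lemma volume_set (P : Cube n) : volume P.set = ENNReal.ofReal (P.l ^ n) := by
  rw [set_eq_preimage, (EuclideanSpace.volume_preserving_symm_measurableEquiv_toLp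
    (Fin n)).measure_preimage (MeasurableSet.univ_pi fun i => measurableSet_Ico).nullMeasurableSet,
    Real.volume_pi_Ico]
  simp [ENNReal.ofReal_pow P.pos.le]

lemma volume_set_toReal (P : Cube n) : (volume P.set).toReal = P.l ^ n := by
  rw [volume_set, ENNReal.toReal_ofReal (pow_nonneg P.pos.le n)]

lemma volume_set_ne_top (P : Cube n) : volume P.set ≠ ⊤ := by
  rw [volume_set]
  exact ENNReal.ofReal_ne_top

lemma volume_set_pos (P : Cube n) : 0 < volume P.set := by
  rw [volume_set]
  exact ENNReal.ofReal_pos.2 (pow_pos P.pos n)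

lemma Sub.eFree {P Q : Cube n} (h : Q.Sub P) (hP : EFree E P) : EFree E Q :=
  Set.subset_eq_empty (Set.inter_subset_inter_left _ h.set_subset) hP

/-- A cube of any intermediate side length fits between two nested cubes. -/
lemma Sub.exists_between {P R : Cube n} (h : P.Sub R) {L : ℝ} (hP : P.l ≤ L) (hR : L ≤ R.l) :
    ∃ Q : Cube n, P.Sub Q ∧ Q.Sub R ∧ Q.l = L := by
  refine ⟨⟨WithLp.toLp 2 fun i => max (R.a i) (P.a i + P.l - L), L, P.pos.trans_le hP⟩,
    fun i => ⟨?_, ?_⟩, fun i => ⟨?_, ?_⟩, rfl⟩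
  · exact max_le (h i).1 (by linarith)
  · have := le_max_right (R.a i) (P.a i + P.l - L)
    simp only
    linarith
  · exact le_max_left _ _
  · have : max (R.a i) (P.a i + P.l - L) ≤ R.a i + R.l - L :=
      max_le (by linarith) (by linarith [(h i).2])
    simp only
    linarith

/-- The supremum of the side lengths of `E`-free cubes contained in `P`. -/
noncomputable def hole (E : Set (EuclideanSpace ℝ (Fin n))) (P : Cube n) : ℝ :=
  sSup {t : ℝ | ∃ Q : Cube n, Q.Sub P ∧ EFree E Q ∧ Q.l = t}

lemma le_hole [NeZero n] {P Q : Cube n} (h : Q.Sub P) (hQ : EFree E Q) : Q.l ≤ hole E P :=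
  le_csSup ⟨P.l, by rintro _ ⟨R, hR, -, rfl⟩; exact hR.l_le⟩ ⟨Q, h, hQ, rfl⟩

lemma hole_le {P : Cube n} {b : ℝ} (hb : 0 ≤ b)
    (h : ∀ Q : Cube n, Q.Sub P → EFree E Q → Q.l ≤ b) : hole E P ≤ b :=
  Real.sSup_le (by rintro _ ⟨R, hR, hE, rfl⟩; exact h R hR hE) hb

lemma hole_nonneg (P : Cube n) : 0 ≤ hole E P :=
  Real.sSup_nonneg (by rintro _ ⟨R, -, -, rfl⟩; exact R.pos.le)

lemma hole_le_l [NeZero n] (P : Cube n) : hole E P ≤ P.l :=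
  hole_le P.pos.le fun _ h _ => h.l_le

lemma _root_.IsDyadicSubcube.sub {P Q : Cube n} (h : IsDyadicSubcube P Q) : Q.Sub P := by
  obtain ⟨j, k, hk, hl, ha⟩ := h
  have hP := P.pos
  intro i
  rw [ha i, hl]
  have h2 : (0 : ℝ) < 2 ^ j := by positivity
  have hk' : (k i : ℝ) + 1 ≤ 2 ^ j := by exact_mod_cast hk i
  refine ⟨by simp only [le_add_iff_nonneg_right]; positivity, ?_⟩
  have : P.l * k i / 2 ^ j + P.l / 2 ^ j ≤ P.l := by
    rw [← add_div, div_le_iff₀ h2]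
    nlinarith
  linarith

lemma isDyadicSubcube_refl (P : Cube n) : IsDyadicSubcube P P :=
  ⟨0, fun _ => 0, by simp, by simp, by simp⟩

lemma sub_of_level_le {P Q R : Cube n} {j j' : ℕ} {k k' : Fin n → ℕ}
    (hlQ : Q.l = P.l / 2 ^ j) (haQ : ∀ i, Q.a i = P.a i + P.l * k i / 2 ^ j)
    (hlR : R.l = P.l / 2 ^ j') (haR : ∀ i, R.a i = P.a i + P.l * k' i / 2 ^ j')
    (hj : j ≤ j') {x : EuclideanSpace ℝ (Fin n)} (hxQ : x ∈ Q.set) (hxR : x ∈ R.set) :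
    R.Sub Q := by
  obtain ⟨d, rfl⟩ := Nat.exists_eq_add_of_le hj
  intro i
  have hl := R.pos
  have hQl : Q.l = R.l * 2 ^ d := by
    rw [hlQ, hlR, pow_add]; field_simp
  have hQa : Q.a i = P.a i + R.l * (k i * 2 ^ d : ℕ) := by
    rw [haQ, hlR, pow_add]; push_cast; field_simp
  have hRa : R.a i = P.a i + R.l * k' i := by
    rw [haR, hlR]; field_simp
  have h1 := hxQ i
  have h2 := hxR i
  have e1 : k i * 2 ^ d ≤ k' i := by
    have : ((k i * 2 ^ d : ℕ) : ℝ) < k' i + 1 := by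
      refine lt_of_mul_lt_mul_left ?_ hl.le
      linarith [h1.1, h2.2]
    exact Nat.lt_succ_iff.1 (by exact_mod_cast this)
  have e2 : k' i + 1 ≤ k i * 2 ^ d + 2 ^ d := by
    have : (k' i : ℝ) < (k i * 2 ^ d : ℕ) + 2 ^ d := by
      refine lt_of_mul_lt_mul_left ?_ hl.le
      linarith [h1.2, h2.1]
    exact_mod_cast this
  have e1' : ((k i * 2 ^ d : ℕ) : ℝ) ≤ k' i := by exact_mod_cast e1
  have e2' : (k' i : ℝ) + 1 ≤ (k i * 2 ^ d : ℕ) + 2 ^ d := by exact_mod_cast e2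
  rw [hQl, hQa, hRa]
  constructor <;> nlinarith

lemma _root_.IsDyadicSubcube.sub_or_sub {P Q R : Cube n} (hQ : IsDyadicSubcube P Q)
    (hR : IsDyadicSubcube P R) (h : (Q.set ∩ R.set).Nonempty) : Q.Sub R ∨ R.Sub Q := by
  obtain ⟨j, k, -, hlQ, haQ⟩ := hQ
  obtain ⟨j', k', -, hlR, haR⟩ := hR
  obtain ⟨x, hxQ, hxR⟩ := h
  rcases le_total j j' with hj | hj
  · exact Or.inr (sub_of_level_le hlQ haQ hlR haR hj hxQ hxR)
  · exact Or.inl (sub_of_level_le hlR haR hlQ haQ hj hxR hxQ)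

/-- Any subcube contains a dyadic subcube of comparable size. -/
lemma Sub.exists_dyadic [NeZero n] {P Q : Cube n} (h : Q.Sub P) :
    ∃ R : Cube n, IsDyadicSubcube P R ∧ R.Sub Q ∧ Q.l / 4 ≤ R.l := by
  have hP := P.pos
  have hQ := Q.pos
  have hQP := h.l_le
  have hex : ∃ j : ℕ, P.l / 2 ^ j ≤ Q.l / 2 := by
    obtain ⟨j, hj⟩ := pow_unbounded_of_one_lt (P.l / (Q.l / 2)) (one_lt_two (α := ℝ))
    refine ⟨j, ?_⟩
    rw [div_lt_iff₀ (by positivity)] at hj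
    rw [div_le_iff₀ (by positivity)]
    linarith
  classical
  obtain ⟨j, hj, hmin⟩ : ∃ j : ℕ, P.l / 2 ^ j ≤ Q.l / 2 ∧ Q.l / 4 ≤ P.l / 2 ^ j := by
    refine ⟨Nat.find hex, Nat.find_spec hex, ?_⟩
    rcases hj : Nat.find hex with _ | j
    · simp only [pow_zero, div_one]; linarith
    · have := Nat.find_min hex (m := j) (by omega)
      rw [pow_succ, ← div_div]
      linarith
  set s := P.l / 2 ^ j with hs
  have hspos : 0 < s := by positivity
  have hPs : P.l = s * 2 ^ j := by rw [hs]; field_simp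
  let k : Fin n → ℕ := fun i => ⌈(Q.a i - P.a i) / s⌉₊
  have hk1 : ∀ i, Q.a i ≤ P.a i + s * k i := fun i => by
    have := Nat.le_ceil ((Q.a i - P.a i) / s)
    rw [div_le_iff₀ hspos] at this
    simp only [k]; linarith
  have hk2 : ∀ i, P.a i + s * k i < Q.a i + s := fun i => by
    have := Nat.ceil_lt_add_one (a := (Q.a i - P.a i) / s)
      (div_nonneg (by linarith [(h i).1]) hspos.le)
    have h3 : s * (k i : ℝ) < s * ((Q.a i - P.a i) / s + 1) := mul_lt_mul_of_pos_left this hspos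
    rw [mul_add, mul_div_cancel₀ _ hspos.ne'] at h3
    linarith
  refine ⟨⟨WithLp.toLp 2 fun i => P.a i + s * k i, s, hspos⟩,
    ⟨j, k, fun i => ?_, rfl, fun i => ?_⟩, fun i => ⟨hk1 i, ?_⟩, hmin⟩
  · have : (k i : ℝ) < 2 ^ j := by
      refine lt_of_mul_lt_mul_left ?_ hspos.le
      linarith [(h i).2, hk2 i]
    exact_mod_cast this
  · simp only [hs]; ring
  · have := hk2 i
    simp only
    linarith

/-- The dyadic children of a cube. -/
noncomputable def child (P : Cube n) (e : Fin n → Fin 2) : Cube n :=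
  ⟨WithLp.toLp 2 fun i => P.a i + P.l / 2 * (e i : ℕ), P.l / 2, half_pos P.pos⟩

lemma child_sub (P : Cube n) (e : Fin n → Fin 2) : (P.child e).Sub P := by
  intro i
  have hP := P.pos
  have he : ((e i : ℕ) : ℝ) ≤ 1 := by exact_mod_cast Nat.lt_succ_iff.1 (e i).2
  simp only [child]
  exact ⟨by simp only [le_add_iff_nonneg_right]; positivity, by nlinarith⟩

lemma isDyadicSubcube_child {P S : Cube n} (hS : IsDyadicSubcube P S) (e : Fin n → Fin 2) :
    IsDyadicSubcube P (S.child e) := by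
  obtain ⟨j, k, hk, hl, ha⟩ := hS
  refine ⟨j + 1, fun i => 2 * k i + (e i : ℕ), fun i => ?_, ?_, fun i => ?_⟩
  · have := hk i
    have := (e i).2
    simp only [pow_succ]; omega
  · simp only [child, hl, pow_succ, div_div]
  · simp only [child, hl, ha, pow_succ]
    push_cast
    field_simp
    ring

lemma iUnion_child (P : Cube n) : ⋃ e, (P.child e).set = P.set := by
  refine Set.Subset.antisymm (Set.iUnion_subset fun e => (P.child_sub e).set_subset) fun x hx => ?_
  classical
  refine Set.mem_iUnion.2 ⟨fun i => if x i < P.a i + P.l / 2 then 0 else 1, fun i => ?_⟩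
  have := hx i
  simp only [child]
  split_ifs with h
  · simp only [Fin.val_zero, Nat.cast_zero]; constructor <;> linarith
  · simp only [Fin.val_one, Nat.cast_one]; constructor <;> linarith

lemma pairwise_disjoint_child (P : Cube n) : Pairwise fun e f =>
    Disjoint (P.child e).set (P.child f).set := by
  intro e f hef
  obtain ⟨i, hi⟩ := Function.ne_iff.1 hef
  refine Set.disjoint_left.2 fun x hx hy => ?_
  have h1 := hx i
  have h2 := hy i
  simp only [child] at h1 h2
  have hP := P.pos
  have he := (e i).2
  have hf := (f i).2
  have hne : (e i : ℕ) ≠ f i := fun h => hi (Fin.ext h)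
  rcases (by omega : ((e i : ℕ) = 0 ∧ (f i : ℕ) = 1) ∨ ((e i : ℕ) = 1 ∧ (f i : ℕ) = 0)) with
    ⟨he, hf⟩ | ⟨he, hf⟩ <;> rw [he] at h1 <;> rw [hf] at h2 <;> push_cast at h1 h2 <;> linarith

lemma measure_le_of_child {P : Cube n} {μ ν : Measure (EuclideanSpace ℝ (Fin n))}
    (h : ∀ e, μ (P.child e).set ≤ ν (P.child e).set) : μ P.set ≤ ν P.set := by
  rw [← P.iUnion_child, measure_iUnion P.pairwise_disjoint_child
    fun e => (P.child e).measurableSet_set, measure_iUnion P.pairwise_disjoint_child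
    fun e => (P.child e).measurableSet_set]
  exact ENNReal.tsum_le_tsum h

/-- A dyadic subcube of a quarter of the side length, away from the boundary. -/
noncomputable def inner (Q : Cube n) : Cube n :=
  ⟨WithLp.toLp 2 fun i => Q.a i + Q.l / 4, Q.l / 4, by linarith [Q.pos]⟩

lemma inner_sub (Q : Cube n) : Q.inner.Sub Q := by
  intro i
  have := Q.pos
  simp only [inner]
  constructor <;> linarith

lemma isDyadicSubcube_inner {P Q : Cube n} (hQ : IsDyadicSubcube P Q) :
    IsDyadicSubcube P Q.inner := by
  obtain ⟨j, k, hk, hl, ha⟩ := hQ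
  refine ⟨j + 2, fun i => 4 * k i + 1, fun i => ?_, ?_, fun i => ?_⟩
  · have := hk i
    simp only [pow_add]; omega
  · simp only [inner, hl, pow_add]
    field_simp
    norm_num
  · simp only [inner, hl, ha, pow_add]
    push_cast
    field_simp
    ring

lemma le_infDist_of_mem_inner {Q : Cube n} (hE : E.Nonempty) (hQ : EFree E Q)
    {x : EuclideanSpace ℝ (Fin n)} (hx : x ∈ Q.inner.set) : Q.l / 4 ≤ infDist x E := by
  refine (le_infDist hE).2 fun y hy => ?_
  have hyQ : y ∉ Q.set := fun h => (Set.mem_empty_iff_false y).1 (hQ ▸ ⟨h, hy⟩)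
  simp only [Cube.set, Set.mem_ofPred_eq, not_forall] at hyQ
  obtain ⟨i, hi⟩ := hyQ
  have hxi := hx i
  simp only [inner] at hxi
  rw [dist_eq_norm]
  refine le_trans ?_ (PiLp.norm_apply_le (x - y) i)
  rw [PiLp.sub_apply, Real.norm_eq_abs]
  by_contra hlt
  rw [not_le, abs_lt] at hlt
  exact hi ⟨by linarith, by linarith⟩

end Cube

namespace Cube

variable {n : ℕ} {E : Set (EuclideanSpace ℝ (Fin n))}

lemma Sub.hole_le_hole [NeZero n] {P R : Cube n} (h : P.Sub R) : P.hole E ≤ R.hole E :=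
  hole_le (hole_nonneg R) fun _ hQ hE => le_hole (hQ.trans h) hE

/-- Enlarging a cube enlarges its largest hole by at most the increase of the side length. -/
lemma Sub.hole_le_add [NeZero n] {P R : Cube n} (h : P.Sub R) :
    R.hole E ≤ P.hole E + (R.l - P.l) := by
  have hl := h.l_le
  have hP := hole_nonneg (E := E) P
  refine hole_le (by linarith) fun Q hQ hE => ?_
  rcases le_or_gt Q.l (R.l - P.l) with hlt | hlt
  · linarith
  let S : Cube n := ⟨WithLp.toLp 2 fun i => max (Q.a i) (P.a i), Q.l - (R.l - P.l), by linarith⟩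
  have hSQ : S.Sub Q := fun i => by
    have : max (Q.a i) (P.a i) ≤ Q.a i + (R.l - P.l) :=
      max_le (by linarith) (by linarith [(hQ i).1, (h i).2])
    exact ⟨le_max_left _ _, by simp only [S]; linarith⟩
  have hSP : S.Sub P := fun i => by
    have : max (Q.a i) (P.a i) ≤ P.a i + P.l - (Q.l - (R.l - P.l)) :=
      max_le (by linarith [(hQ i).2, (h i).1]) (by linarith [hQ.l_le])
    exact ⟨le_max_right _ _, by simp only [S]; linarith⟩
  have : S.l ≤ P.hole E := le_hole hSP (hSQ.eFree hE)
  simp only [S] at this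
  linarith

lemma sum_pow_eq_measureReal {N : ℕ} {Q : Fin N → Cube n}
    (hd : ∀ k m, k ≠ m → Disjoint (Q k).set (Q m).set) :
    ∑ k, (Q k).l ^ n = volume.real (⋃ k, (Q k).set) := by
  rw [measureReal_def, measure_iUnion (fun k m h => hd k m h) fun k => (Q k).measurableSet_set,
    tsum_fintype, ENNReal.toReal_sum fun k _ => (Q k).volume_set_ne_top]
  simp_rw [volume_set_toReal]

lemma measureReal_sdiff {P : Cube n} {U : Set (EuclideanSpace ℝ (Fin n))} (hU : MeasurableSet U)
    (h : U ⊆ P.set) : volume.real (P.set \ U) = P.l ^ n - volume.real U := by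
  rw [MeasureTheory.measureReal_sdiff h hU P.volume_set_ne_top, measureReal_def volume P.set,
    volume_set_toReal]

end Cube

namespace WeaklyPorousWith

variable {n : ℕ} {E : Set (EuclideanSpace ℝ (Fin n))} {c δ : ℝ}

lemma exists_free [NeZero n] (h : WeaklyPorousWith E c δ) (hδ0 : 0 < δ) (hδ1 : δ < 1)
    (P : Cube n) : ∃ (N : ℕ) (Q : Fin N → Cube n),
      (∀ k, IsDyadicSubcube P (Q k) ∧ EFree E (Q k)) ∧
      (∀ k m, k ≠ m → Disjoint (Q k).set (Q m).set) ∧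
      (∀ k, δ / 4 * P.hole E ≤ (Q k).l) ∧ c * P.l ^ n ≤ ∑ k, (Q k).l ^ n := by
  obtain ⟨N, Q, hQ, hd, hm, hs⟩ := h P
  refine ⟨N, Q, hQ, hd, fun k => ?_, by simpa only [Cube.volume_set_toReal] using hs⟩
  have hk := (Q k).pos
  rw [← le_div_iff₀' (by positivity)]
  refine Cube.hole_le (by positivity) fun R hR hE => ?_
  obtain ⟨S, hSP, hSR, hS⟩ := hR.exists_dyadic
  have hmax : S.l ^ n ≤ maxFree E P := by
    refine le_csSup ⟨P.l ^ n, ?_⟩ ⟨S, hSP, hSR.eFree hE, S.volume_set_toReal.symm⟩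
    rintro _ ⟨D, hD, -, rfl⟩
    rw [D.volume_set_toReal]
    exact pow_le_pow_left₀ D.pos.le hD.sub.l_le n
  have hR0 := R.pos
  have : (δ * (R.l / 4)) ^ n ≤ (Q k).l ^ n := calc
    (δ * (R.l / 4)) ^ n = δ ^ n * (R.l / 4) ^ n := mul_pow _ _ _
    _ ≤ δ * S.l ^ n := by
      gcongr
      exact pow_le_of_le_one hδ0.le hδ1.le (NeZero.ne n)
    _ ≤ δ * maxFree E P := by gcongr
    _ ≤ (Q k).l ^ n := by simpa only [Cube.volume_set_toReal] using hm k
  have := le_of_pow_le_pow_left₀ (NeZero.ne n) hk.le this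
  rw [le_div_iff₀' (by positivity)]
  linarith

lemma hole_pos [NeZero n] (h : WeaklyPorousWith E c δ) (hc0 : 0 < c) (P : Cube n) :
    0 < P.hole E := by
  obtain ⟨N, Q, hQ, -, -, hs⟩ := h P
  rcases N with _ | N
  · have := pow_pos P.pos n
    simp only [Cube.volume_set_toReal, Finset.univ_eq_empty, Finset.sum_empty] at hs
    nlinarith
  · exact (Q 0).pos.trans_le (Cube.le_hole (hQ 0).1.sub (hQ 0).2)

/-- Slightly enlarging a cube enlarges its largest hole by at most a constant factor. -/
lemma hole_le_of_l_le [NeZero n] (h : WeaklyPorousWith E c δ) (hc0 : 0 < c) (hc1 : c < 1)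
    (hδ0 : 0 < δ) (hδ1 : δ < 1) {P R : Cube n} (hPR : P.Sub R)
    (hl : R.l ≤ (1 + c / (6 * n)) * P.l) : δ / 4 * R.hole E ≤ P.hole E := by
  by_contra! hlt
  obtain ⟨N, Q, hQ, hd, hm, hs⟩ := h.exists_free hδ0 hδ1 R
  have hn : (1 : ℝ) ≤ n := by exact_mod_cast NeZero.one_le
  have hP := P.pos
  have hR := R.pos
  set s := c / (6 * n) with hs_def
  have hs0 : 0 < s := by positivity
  have hns : 6 * (n * s) = c := by rw [hs_def]; field_simp
  have hs6 : 6 * s < 1 := by nlinarith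
  have hhR : R.hole E ≤ 2 * s * P.l := by
    have h1 := hPR.hole_le_add (E := E)
    have h2 := Cube.hole_nonneg (E := E) R
    nlinarith
  let I : Cube n := ⟨WithLp.toLp 2 fun i => P.a i + 2 * s * P.l, (1 - 4 * s) * P.l,
    mul_pos (by linarith) hP⟩
  have hIP : I.Sub P := fun i => by
    have : 0 < s * P.l := by positivity
    simp only [I]
    constructor <;> linarith
  have hQI : ⋃ k, (Q k).set ⊆ R.set \ I.set := by
    refine Set.iUnion_subset fun k x hx => ⟨(hQ k).1.sub.set_subset hx, fun hxI => ?_⟩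
    have hQl : (Q k).l ≤ R.hole E := Cube.le_hole (hQ k).1.sub (hQ k).2
    have hQP : (Q k).Sub P := fun i => by
      have h1 := hx i
      have h2 := hxI i
      simp only [I] at h2
      constructor <;> linarith
    have := Cube.le_hole hQP (hQ k).2
    linarith [hm k]
  have hvol : c * R.l ^ n ≤ R.l ^ n - I.l ^ n := by
    refine hs.trans ?_
    rw [Cube.sum_pow_eq_measureReal hd]
    refine (measureReal_mono hQI (measure_ne_top_of_subset Set.sdiff_subset
      R.volume_set_ne_top)).trans ?_
    rw [Cube.measureReal_sdiff I.measurableSet_set (hIP.trans hPR).set_subset, measureReal_def,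
      Cube.volume_set_toReal]
  have hIl : (1 - 5 * s) * R.l ≤ I.l := by
    have : (1 - 5 * s) * R.l ≤ (1 - 5 * s) * ((1 + s) * P.l) :=
      mul_le_mul_of_nonneg_left hl (by linarith)
    have : 0 ≤ s * s * P.l := by positivity
    simp only [I]
    linarith
  have hpow : (1 - 5 * c / 6) * R.l ^ n ≤ I.l ^ n := by
    have hb := one_add_mul_le_pow (a := -(5 * s)) (by linarith) n
    have : (1 - 5 * c / 6) ≤ (1 - 5 * s) ^ n := by
      rw [sub_eq_add_neg 1 (5 * s)]
      linarith
    calc _ ≤ (1 - 5 * s) ^ n * R.l ^ n := by gcongr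
      _ = ((1 - 5 * s) * R.l) ^ n := (mul_pow _ _ _).symm
      _ ≤ _ := pow_le_pow_left₀ (mul_nonneg (by linarith) hR.le) hIl n
  have := pow_pos hR n
  nlinarith

lemma hole_le_of_l_le_pow [NeZero n] (h : WeaklyPorousWith E c δ) (hc0 : 0 < c) (hc1 : c < 1)
    (hδ0 : 0 < δ) (hδ1 : δ < 1) (m : ℕ) {P R : Cube n} (hPR : P.Sub R)
    (hl : R.l ≤ (1 + c / (6 * n)) ^ m * P.l) : (δ / 4) ^ m * R.hole E ≤ P.hole E := by
  induction m generalizing R with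
  | zero =>
    rw [pow_zero, one_mul] at hl ⊢
    refine Cube.Sub.hole_le_hole fun i => ?_
    constructor <;> linarith [(hPR i).1, (hPR i).2]
  | succ m ih =>
    have hs : 1 ≤ 1 + c / (6 * n) := by simp only [le_add_iff_nonneg_right]; positivity
    have hR := R.pos
    have hP := P.pos
    obtain ⟨Q, hPQ, hQR, hQ⟩ := hPR.exists_between (L := max P.l (R.l / (1 + c / (6 * n))))
      (le_max_left _ _) (max_le hPR.l_le (div_le_self hR.le hs))
    have h1 : (δ / 4) ^ m * Q.hole E ≤ P.hole E := by
      refine ih hPQ (hQ ▸ max_le (le_mul_of_one_le_left hP.le (one_le_pow₀ hs)) ?_)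
      rw [div_le_iff₀ (by positivity)]
      rw [pow_succ] at hl
      linarith
    have h2 : δ / 4 * R.hole E ≤ Q.hole E := by
      refine h.hole_le_of_l_le hc0 hc1 hδ0 hδ1 hQR ?_
      rw [hQ, ← div_le_iff₀' (by positivity)]
      exact le_max_right _ _
    calc (δ / 4) ^ (m + 1) * R.hole E = (δ / 4) ^ m * (δ / 4 * R.hole E) := by ring
      _ ≤ (δ / 4) ^ m * Q.hole E := by gcongr
      _ ≤ _ := h1

/-- Largest holes of dyadic children are comparable to the largest hole of the parent. -/
lemma exists_hole_child (n : ℕ) [NeZero n] {c δ : ℝ} (hc0 : 0 < c) (hc1 : c < 1)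
    (hδ0 : 0 < δ) (hδ1 : δ < 1) :
    ∃ κ : ℝ, 0 < κ ∧ κ ≤ 1 ∧ ∀ E : Set (EuclideanSpace ℝ (Fin n)), WeaklyPorousWith E c δ →
      ∀ (P : Cube n) (e : Fin n → Fin 2), κ * P.hole E ≤ (P.child e).hole E := by
  have hn : (0 : ℝ) < n := by exact_mod_cast NeZero.pos n
  have hs : 1 < 1 + c / (6 * n) := by simp only [lt_add_iff_pos_right]; positivity
  obtain ⟨m, hm⟩ := pow_unbounded_of_one_lt 2 hs
  refine ⟨(δ / 4) ^ m, by positivity, pow_le_one₀ (by positivity) (by linarith),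
    fun E h P e => h.hole_le_of_l_le_pow hc0 hc1 hδ0 hδ1 m (P.child_sub e) ?_⟩
  have := P.pos
  simp only [Cube.child]
  nlinarith

end WeaklyPorousWith

section ExtendedWeight

variable {n : ℕ} {E : Set (EuclideanSpace ℝ (Fin n))}

/-- The distance weight with values in `[0, ∞]`, infinite on the closure of `E`. -/
noncomputable def edistw (E : Set (EuclideanSpace ℝ (Fin n))) (α : ℝ)
    (x : EuclideanSpace ℝ (Fin n)) : ENNReal :=
  ENNReal.ofReal (infDist x E) ^ (-α)

lemma measurable_edistw (E : Set (EuclideanSpace ℝ (Fin n))) (α : ℝ) :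
    Measurable (edistw E α) :=
  (measurable_infDist.ennreal_ofReal).pow_const _

lemma edistw_le {α τ : ℝ} (hα : 0 < α) (hτ : 0 < τ) {x : EuclideanSpace ℝ (Fin n)}
    (hx : τ ≤ infDist x E) : edistw E α x ≤ ENNReal.ofReal (τ ^ (-α)) := by
  rw [edistw, ENNReal.ofReal_rpow_of_pos (hτ.trans_le hx)]
  exact ENNReal.ofReal_le_ofReal (Real.rpow_le_rpow_of_nonpos hτ hx (by linarith))

lemma ofReal_distw_le {α : ℝ} (hα : 0 < α) (x : EuclideanSpace ℝ (Fin n)) :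
    ENNReal.ofReal (distw E α x) ≤ edistw E α x := by
  rcases (infDist_nonneg (s := E) (x := x)).eq_or_lt with h | h
  · rw [distw, ← h, Real.zero_rpow (by linarith), ENNReal.ofReal_zero]
    exact zero_le
  · rw [distw, edistw, ENNReal.ofReal_rpow_of_pos h]

end ExtendedWeight

namespace Cube

variable {n : ℕ} {E : Set (EuclideanSpace ℝ (Fin n))}

/-- Stopping-time estimate: the integral of `f` is controlled by `a` on the free cubes `V k` and
by `B` on the complement of these. -/
lemma lintegral_le_of_stopping [NeZero n] {κ τ : ℝ} (hκ : 0 < κ) (hτ : 0 < τ)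
    (hchild : ∀ (P : Cube n) (e : Fin n → Fin 2), κ * P.hole E ≤ (P.child e).hole E)
    {f : EuclideanSpace ℝ (Fin n) → ENNReal} {a B : ENNReal}
    (hB : ∀ R : Cube n, κ * τ ≤ R.hole E → ∫⁻ x in R.set, f x ≤ B * volume R.set)
    {P : Cube n} {N : ℕ} {V : Fin N → Cube n}
    (hV : ∀ k, IsDyadicSubcube P (V k) ∧ EFree E (V k)) (hVl : ∀ k, τ ≤ (V k).l)
    (ha : ∀ k, ∀ x ∈ (V k).set, f x ≤ a) {S : Cube n} (hS : IsDyadicSubcube P S)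
    (hSτ : κ * τ ≤ S.hole E) :
    ∫⁻ x in S.set, f x ≤ a * volume S.set + B * volume (S.set \ ⋃ k, (V k).set) := by
  set U := ⋃ k, (V k).set with hU
  set ν : Measure (EuclideanSpace ℝ (Fin n)) := a • volume + B • volume.restrict Uᶜ
  have hν : ∀ S : Cube n, ν S.set = a * volume S.set + B * volume (S.set \ U) := fun S => by
    rw [Measure.add_apply, Measure.smul_apply, Measure.smul_apply,
      Measure.restrict_apply S.measurableSet_set, smul_eq_mul, smul_eq_mul, ← Set.sdiff_eq]
  have hsmall : ∀ S : Cube n, IsDyadicSubcube P S → κ * τ ≤ S.hole E → S.hole E < τ →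
      volume.withDensity f S.set ≤ ν S.set := by
    intro S hS hSκ hSτ
    rw [withDensity_apply _ S.measurableSet_set, hν]
    by_cases hSU : Disjoint S.set U
    · rw [hSU.sdiff_eq_left]
      exact (hB S hSκ).trans le_add_self
    · obtain ⟨x, hxS, hxU⟩ := Set.not_disjoint_iff.1 hSU
      obtain ⟨k, hxk⟩ := Set.mem_iUnion.1 hxU
      rcases hS.sub_or_sub (hV k).1 ⟨x, hxS, hxk⟩ with hsub | hsub
      · refine le_trans ?_ le_self_add
        rw [← setLIntegral_const]
        exact setLIntegral_mono' S.measurableSet_set fun y hy => ha k y (hsub.set_subset hy)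
      · exact absurd ((hVl k).trans (le_hole hsub (hV k).2)) (not_le.2 hSτ)
  have key : ∀ (j : ℕ) (S : Cube n), IsDyadicSubcube P S → κ * τ ≤ S.hole E → S.l < 2 ^ j * τ →
      volume.withDensity f S.set ≤ ν S.set := by
    intro j
    induction j with
    | zero =>
      intro S hS hSκ hSj
      exact hsmall S hS hSκ (S.hole_le_l.trans_lt (by simpa using hSj))
    | succ j ih =>
      intro S hS hSκ hSj
      rcases lt_or_ge (S.hole E) τ with hSτ | hSτ
      · exact hsmall S hS hSκ hSτ
      · refine measure_le_of_child fun e => ih _ (isDyadicSubcube_child hS e)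
          ((mul_le_mul_of_nonneg_left hSτ hκ.le).trans (hchild S e)) ?_
        simp only [child]
        rw [pow_succ] at hSj
        linarith
  obtain ⟨j, hj⟩ := pow_unbounded_of_one_lt (S.l / τ) (one_lt_two (α := ℝ))
  have := key j S hS hSτ ((div_lt_iff₀ hτ).1 hj)
  rwa [withDensity_apply _ S.measurableSet_set, hν] at this

end Cube

namespace WeaklyPorousWith

variable {n : ℕ} {E : Set (EuclideanSpace ℝ (Fin n))} {c δ : ℝ}

/-- Uniformly large free dyadic cubes that stay away from `E`, filling a fixed portion. -/
lemma exists_far [NeZero n] (h : WeaklyPorousWith E c δ) (hE : E.Nonempty) (hδ0 : 0 < δ)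
    (hδ1 : δ < 1) (P : Cube n) : ∃ (N : ℕ) (V : Fin N → Cube n),
      (∀ k, IsDyadicSubcube P (V k) ∧ EFree E (V k)) ∧ (∀ k, δ / 16 * P.hole E ≤ (V k).l) ∧
      (∀ k, ∀ x ∈ (V k).set, δ / 16 * P.hole E ≤ infDist x E) ∧
      volume (P.set \ ⋃ k, (V k).set) ≤ ENNReal.ofReal (1 - c / 4 ^ n) * volume P.set := by
  obtain ⟨N, Q, hQ, hd, hm, hs⟩ := h.exists_free hδ0 hδ1 P
  refine ⟨N, fun k => (Q k).inner, fun k => ⟨Cube.isDyadicSubcube_inner (hQ k).1,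
    (Q k).inner_sub.eFree (hQ k).2⟩, fun k => ?_, fun k x hx => ?_, ?_⟩
  · simp only [Cube.inner]
    linarith [hm k]
  · exact le_trans (by linarith [hm k]) (Cube.le_infDist_of_mem_inner hE (hQ k).2 hx)
  · have hsub : ⋃ k, (Q k).inner.set ⊆ P.set := Set.iUnion_subset fun k =>
      ((Q k).inner_sub.trans (hQ k).1.sub).set_subset
    have hsum : ∑ k, (Q k).inner.l ^ n = volume.real (⋃ k, (Q k).inner.set) :=
      Cube.sum_pow_eq_measureReal fun k m hkm =>
        (hd k m hkm).mono (Q k).inner_sub.set_subset (Q m).inner_sub.set_subset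
    simp only [Cube.inner, div_pow, ← Finset.sum_div] at hsum
    have hP := pow_pos P.pos n
    rw [P.volume_set, ← ENNReal.ofReal_mul' hP.le, ← ofReal_measureReal
      (measure_ne_top_of_subset Set.sdiff_subset P.volume_set_ne_top),
      Cube.measureReal_sdiff (MeasurableSet.iUnion fun k => (Q k).inner.measurableSet_set) hsub]
    refine ENNReal.ofReal_le_ofReal ?_
    have : c * P.l ^ n / 4 ^ n ≤ volume.real (⋃ k, (Q k).inner.set) := by
      refine le_trans ?_ hsum.le
      gcongr
    rw [mul_div_right_comm] at this
    linarith

lemma lintegral_min_edistw_le [NeZero n] (h : WeaklyPorousWith E c δ) (hE : E.Nonempty)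
    (hc0 : 0 < c) (hc1 : c < 1) (hδ0 : 0 < δ) (hδ1 : δ < 1) {κ : ℝ} (hκ : 0 < κ) (hκ1 : κ ≤ 1)
    (hchild : ∀ (P : Cube n) (e : Fin n → Fin 2), κ * P.hole E ≤ (P.child e).hole E)
    {α A : ℝ} (hα : 0 < α) (hA : 0 ≤ A)
    (hαA : (κ * (δ / 16)) ^ (-α) * (1 + A * (1 - c / 4 ^ n)) ≤ A) (T m : ℕ) (P : Cube n) :
    ∫⁻ x in P.set, min (edistw E α x) T ≤
      ENNReal.ofReal (A * P.hole E ^ (-α) + (1 - c / 4 ^ n) ^ m * T) * volume P.set := by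
  have hq : 0 ≤ 1 - c / 4 ^ n := by
    have : c / 4 ^ n ≤ 1 := by
      rw [div_le_one (by positivity)]
      exact hc1.le.trans (one_le_pow₀ (by norm_num))
    linarith
  induction m generalizing P with
  | zero =>
    have hP := Real.rpow_nonneg (Cube.hole_nonneg (E := E) P) (-α)
    calc _ ≤ ∫⁻ x in P.set, (T : ENNReal) := lintegral_mono fun x => min_le_right _ _
      _ = T * volume P.set := setLIntegral_const _ _
      _ ≤ _ := by
        gcongr
        rw [← ENNReal.ofReal_natCast]
        refine ENNReal.ofReal_le_ofReal ?_
        rw [pow_zero, one_mul]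
        linarith [mul_nonneg hA hP]
  | succ m ih =>
    have hP := h.hole_pos hc0 P
    obtain ⟨N, V, hV, hVl, hVE, hvol⟩ := h.exists_far hE hδ0 hδ1 P
    set q := 1 - c / 4 ^ n
    set τ := δ / 16 * P.hole E with hτ_def
    have hτ : 0 < τ := by positivity
    have hκτ : κ * τ ≤ P.hole E := by
      rw [hτ_def, ← mul_assoc]
      refine mul_le_of_le_one_left hP.le ?_
      nlinarith
    have hB : ∀ R : Cube n, κ * τ ≤ R.hole E → ∫⁻ x in R.set, min (edistw E α x) T ≤
        ENNReal.ofReal (A * (κ * τ) ^ (-α) + q ^ m * T) * volume R.set := fun R hR => by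
      refine (ih R).trans ?_
      have := Real.rpow_le_rpow_of_nonpos (z := -α) (by positivity) hR (by linarith)
      gcongr ENNReal.ofReal (A * ?_ + _) * _
    refine (Cube.lintegral_le_of_stopping hκ hτ hchild hB hV hVl
      (fun k x hx => (min_le_left _ _).trans (edistw_le hα hτ (hVE k x hx)))
      P.isDyadicSubcube_refl hκτ).trans ?_
    calc _ ≤ ENNReal.ofReal (τ ^ (-α)) * volume P.set +
          ENNReal.ofReal (A * (κ * τ) ^ (-α) + q ^ m * T) *
            (ENNReal.ofReal q * volume P.set) := by gcongr
      _ = ENNReal.ofReal (τ ^ (-α) + (A * (κ * τ) ^ (-α) + q ^ m * T) * q) * volume P.set := by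
        have : 0 ≤ A * (κ * τ) ^ (-α) + q ^ m * T := by positivity
        rw [ENNReal.ofReal_add (p := τ ^ (-α)) (by positivity) (mul_nonneg this hq),
          ENNReal.ofReal_mul this]
        ring
      _ ≤ _ := by
        refine mul_le_mul_left (ENNReal.ofReal_le_ofReal ?_) _
        have h1 : τ ^ (-α) ≤ (κ * τ) ^ (-α) := Real.rpow_le_rpow_of_nonpos (by positivity)
          (mul_le_of_le_one_left hτ.le hκ1) (by linarith)
        have h2 : (κ * τ) ^ (-α) = (κ * (δ / 16)) ^ (-α) * P.hole E ^ (-α) := by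
          rw [hτ_def, ← mul_assoc, Real.mul_rpow (by positivity) hP.le]
        have h3 := mul_le_mul_of_nonneg_right hαA (Real.rpow_nonneg hP.le (-α))
        rw [h2] at h1 ⊢
        rw [pow_succ]
        linarith

lemma lintegral_edistw_le [NeZero n] (h : WeaklyPorousWith E c δ) (hE : E.Nonempty)
    (hc0 : 0 < c) (hc1 : c < 1) (hδ0 : 0 < δ) (hδ1 : δ < 1) {κ : ℝ} (hκ : 0 < κ) (hκ1 : κ ≤ 1)
    (hchild : ∀ (P : Cube n) (e : Fin n → Fin 2), κ * P.hole E ≤ (P.child e).hole E)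
    {α A : ℝ} (hα : 0 < α) (hA : 0 ≤ A)
    (hαA : (κ * (δ / 16)) ^ (-α) * (1 + A * (1 - c / 4 ^ n)) ≤ A) (P : Cube n) :
    ∫⁻ x in P.set, edistw E α x ≤ ENNReal.ofReal (A * P.hole E ^ (-α) * P.l ^ n) := by
  have hP := P.pos
  have hq0 : 0 ≤ 1 - c / 4 ^ n := by
    have : c / 4 ^ n ≤ 1 := by
      rw [div_le_one (by positivity)]
      exact hc1.le.trans (one_le_pow₀ (by norm_num))
    linarith
  have hq1 : 1 - c / 4 ^ n < 1 := by
    have : 0 < c / 4 ^ n := by positivity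
    linarith
  have hT : ∀ T : ℕ, ∫⁻ x in P.set, min (edistw E α x) T ≤
      ENNReal.ofReal (A * P.hole E ^ (-α) * P.l ^ n) := fun T => by
    rw [ENNReal.ofReal_mul' (by positivity), ← P.volume_set]
    refine ge_of_tendsto' (f := fun m : ℕ =>
      ENNReal.ofReal (A * P.hole E ^ (-α) + (1 - c / 4 ^ n) ^ m * T) * volume P.set)
      (x := Filter.atTop) ?_ fun m => h.lintegral_min_edistw_le hE hc0 hc1 hδ0 hδ1 hκ hκ1
        hchild hα hA hαA T m P
    refine ENNReal.Tendsto.mul_const ?_ (Or.inr P.volume_set_ne_top)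
    refine (ENNReal.continuous_ofReal.tendsto _).comp ?_
    have := ((tendsto_pow_atTop_nhds_zero_of_lt_one hq0 hq1).mul_const (T : ℝ)).const_add
      (A * P.hole E ^ (-α))
    simpa using this
  have hsup : ∀ x, edistw E α x = ⨆ T : ℕ, min (edistw E α x) (T : ENNReal) := fun x => by
    rw [← inf_iSup_eq, ENNReal.iSup_natCast, inf_top_eq]
  rw [lintegral_congr hsup, lintegral_iSup (fun T => (measurable_edistw E α).min measurable_const)
    fun T T' hTT x => min_le_min le_rfl (by exact_mod_cast hTT)]
  exact iSup_le hT

end WeaklyPorousWith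

section Weight

variable {n : ℕ} {E : Set (EuclideanSpace ℝ (Fin n))} {α : ℝ}

lemma EuclideanSpace.dist_le_card_mul {x y : EuclideanSpace ℝ (Fin n)} {t : ℝ} (ht : 0 ≤ t)
    (h : ∀ i, |x i - y i| ≤ t) : dist x y ≤ n * t := by
  rw [EuclideanSpace.dist_eq]
  refine Real.sqrt_le_iff.2 ⟨by positivity, ?_⟩
  calc ∑ i, dist (x i) (y i) ^ 2 ≤ ∑ _i : Fin n, t ^ 2 :=
        Finset.sum_le_sum fun i _ => pow_le_pow_left₀ dist_nonneg (h i) 2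
    _ = n * t ^ 2 := by simp
    _ ≤ (n : ℝ) ^ 2 * t ^ 2 := by
      gcongr
      exact_mod_cast Nat.le_self_pow two_ne_zero n
    _ = (n * t) ^ 2 := (mul_pow _ _ _).symm

lemma Cube.dist_le {P : Cube n} {x y : EuclideanSpace ℝ (Fin n)} (hx : x ∈ P.set)
    (hy : y ∈ P.set) : dist x y ≤ n * P.l :=
  EuclideanSpace.dist_le_card_mul P.pos.le fun i =>
    abs_le.2 ⟨by linarith [(hx i).1, (hy i).2], by linarith [(hx i).2, (hy i).1]⟩

lemma exists_subset_cube {K : Set (EuclideanSpace ℝ (Fin n))} (hK : Bornology.IsBounded K) :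
    ∃ P : Cube n, K ⊆ P.set := by
  obtain ⟨r, hr0, hr⟩ := hK.exists_pos_norm_lt
  refine ⟨⟨WithLp.toLp 2 fun _ => -r, 2 * r, by linarith⟩, fun x hx i => ?_⟩
  have := abs_lt.1 ((PiLp.norm_apply_le x i).trans_lt (hr x hx))
  simp only
  constructor <;> linarith

lemma ae_infDist_pos (hα : 0 < α) (h : ∀ P : Cube n, ∫⁻ x in P.set, edistw E α x ≠ ⊤) :
    ∀ᵐ x : EuclideanSpace ℝ (Fin n), 0 < infDist x E := by
  have hcover : ∀ k : ℕ, ∀ᵐ x : EuclideanSpace ℝ (Fin n) ∂volume.restrict (ball 0 (k : ℝ)),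
      0 < infDist x E := fun k => by
    obtain ⟨P, hP⟩ := exists_subset_cube (n := n) (isBounded_ball (x := 0) (r := (k : ℝ)))
    refine ae_restrict_of_ae_restrict_of_subset hP ?_
    filter_upwards [ae_lt_top (measurable_edistw E α) (h P)] with x hx
    refine infDist_nonneg.lt_of_ne fun h0 => hx.ne ?_
    rw [edistw, ← h0, ENNReal.ofReal_zero, ENNReal.zero_rpow_of_neg (by linarith)]
  rw [← ae_restrict_iUnion_iff, iUnion_ball_nat, Measure.restrict_univ] at hcover
  exact hcover

lemma distw_nonneg (E : Set (EuclideanSpace ℝ (Fin n))) (α : ℝ) (x : EuclideanSpace ℝ (Fin n)) :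
    0 ≤ distw E α x :=
  Real.rpow_nonneg infDist_nonneg _

lemma measurable_distw (E : Set (EuclideanSpace ℝ (Fin n))) (α : ℝ) : Measurable (distw E α) :=
  measurable_infDist.pow_const _

lemma isWeight_distw (hα : 0 < α) (h : ∀ P : Cube n, ∫⁻ x in P.set, edistw E α x ≠ ⊤) :
    IsWeight (distw E α) := by
  refine ⟨locallyIntegrable_iff.2 fun K hK => ?_, ?_⟩
  · obtain ⟨P, hP⟩ := exists_subset_cube hK.isBounded
    refine IntegrableOn.mono_set ⟨(measurable_distw E α).aestronglyMeasurable, ?_⟩ hP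
    rw [hasFiniteIntegral_iff_ofReal (Filter.Eventually.of_forall (distw_nonneg E α))]
    exact (lintegral_mono (ofReal_distw_le hα)).trans_lt (h P).lt_top
  · filter_upwards [ae_infDist_pos hα h] with x hx
    exact Real.rpow_pos_of_pos hx _

lemma average_distw_le (hα : 0 < α) {P : Cube n} {b : ℝ} (hb : 0 ≤ b)
    (h : ∫⁻ x in P.set, edistw E α x ≤ ENNReal.ofReal (b * P.l ^ n)) :
    ⨍ x in P.set, distw E α x ≤ b := by
  have hP := pow_pos P.pos n
  rw [setAverage_eq, measureReal_def, P.volume_set_toReal, smul_eq_mul, inv_mul_le_iff₀ hP,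
    integral_eq_lintegral_of_nonneg_ae (Filter.Eventually.of_forall (distw_nonneg E α))
      (measurable_distw E α).aestronglyMeasurable]
  refine ENNReal.toReal_le_of_le_ofReal (by positivity) ?_
  rw [mul_comm]
  exact (lintegral_mono (ofReal_distw_le hα)).trans h

lemma le_essInf_distw (hα : 0 < α) {P : Cube n}
    (hpos : ∀ᵐ x : EuclideanSpace ℝ (Fin n), 0 < infDist x E) {L : ℝ}
    (hL : ∀ x ∈ P.set, infDist x E ≤ L) :
    L ^ (-α) ≤ essInf (distw E α) (volume.restrict P.set) := by
  have : (ae (volume.restrict P.set)).NeBot := by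
    rw [ae_neBot, Ne, Measure.restrict_eq_zero]
    exact P.volume_set_pos.ne'
  obtain ⟨k, hk⟩ : ∃ k : ℕ, ∃ᶠ x in ae (volume.restrict P.set), distw E α x ≤ k := by
    by_contra! hlt
    obtain ⟨x, hx⟩ := (ae_all_iff.2 hlt).exists
    obtain ⟨k, hk⟩ := exists_nat_ge (distw E α x)
    exact (hx k).not_ge hk
  refine Filter.le_liminf_of_le (Filter.IsCoboundedUnder.of_frequently_le hk) ?_
  filter_upwards [ae_restrict_of_ae hpos, ae_restrict_mem P.measurableSet_set] with x hx hxP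
  exact Real.rpow_le_rpow_of_nonpos hx (hL x hxP) (by linarith)

lemma rpow_neg_le_mul_rpow_neg {x r : ℝ} (hx : 0 < x) (hr : 1 ≤ r) (hα : α < 1) :
    x ^ (-α) ≤ r * (r * x) ^ (-α) := by
  have hr0 : 0 < r := by linarith
  rw [Real.mul_rpow hr0.le hx.le, ← mul_assoc]
  refine le_mul_of_one_le_left (Real.rpow_nonneg hx.le _) ?_
  rw [← Real.rpow_one_add' hr0.le (by linarith)]
  exact Real.one_le_rpow hr (by linarith)

lemma Cube.infDist_le_mul_hole [NeZero n] {P : Cube n} {x : EuclideanSpace ℝ (Fin n)}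
    (hx : x ∈ P.set) (hxE : infDist x E ≤ 2 * n * P.l) : infDist x E ≤ 2 * n * P.hole E := by
  have hn : (0 : ℝ) < n := by exact_mod_cast NeZero.pos n
  rcases (infDist_nonneg (s := E) (x := x)).eq_or_lt with h0 | h0
  · rw [← h0]
    have := Cube.hole_nonneg (E := E) P
    positivity
  set t := infDist x E / (2 * n) with ht
  have ht0 : 0 < t := by positivity
  have hxt : infDist x E = 2 * n * t := by rw [ht]; field_simp
  have htl : t ≤ P.l := by
    rw [ht, div_le_iff₀ (by positivity)]
    linarith
  let Q : Cube n := ⟨WithLp.toLp 2 fun i => max (P.a i) (x i - t), t, ht0⟩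
  have hQP : Q.Sub P := fun i => by
    have : max (P.a i) (x i - t) ≤ P.a i + P.l - t :=
      max_le (by linarith) (by linarith [(hx i).2])
    exact ⟨le_max_left _ _, by simp only [Q]; linarith⟩
  have hQE : EFree E Q := by
    refine Set.eq_empty_iff_forall_notMem.2 fun y ⟨hyQ, hyE⟩ => ?_
    have h1 : dist x y ≤ n * t := EuclideanSpace.dist_le_card_mul ht0.le fun i => by
      have h2 := hyQ i
      simp only [Q] at h2
      have h3 := le_max_right (P.a i) (x i - t)
      have h4 : max (P.a i) (x i - t) ≤ x i := max_le (hx i).1 (by linarith)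
      exact abs_le.2 ⟨by linarith, by linarith⟩
    have := infDist_le_dist_of_mem (x := x) hyE
    nlinarith
  rw [hxt]
  have : t ≤ P.hole E := Cube.le_hole hQP hQE
  gcongr

lemma a1With_distw [NeZero n] (hα : 0 < α) (hα1 : α < 1) {A : ℝ} (hA : 0 ≤ A)
    (hhole : ∀ P : Cube n, 0 < P.hole E)
    (h : ∀ P : Cube n, ∫⁻ x in P.set, edistw E α x ≤
      ENNReal.ofReal (A * P.hole E ^ (-α) * P.l ^ n)) :
    A1With (distw E α) (2 * n * A + 4) := by
  intro P
  have hn : (1 : ℝ) ≤ n := by exact_mod_cast NeZero.one_le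
  have hP := P.pos
  have hpos := ae_infDist_pos hα fun P => ((h P).trans_lt ENNReal.ofReal_lt_top).ne
  by_cases hfar : ∃ x ∈ P.set, 2 * n * P.l < infDist x E
  · obtain ⟨x, hx, hxE⟩ := hfar
    set D := infDist x E
    have hD : 0 < D := lt_trans (by positivity) hxE
    have hess := le_essInf_distw (L := 2 * D) hα hpos fun y hy => by
      have := infDist_le_infDist_add_dist (s := E) (x := y) (y := x)
      linarith [Cube.dist_le hy hx]
    have hav : ⨍ y in P.set, distw E α y ≤ (D / 2) ^ (-α) := by
      refine average_distw_le hα (by positivity) ?_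
      rw [ENNReal.ofReal_mul (by positivity), ← P.volume_set, ← setLIntegral_const]
      refine setLIntegral_mono' P.measurableSet_set fun y hy => edistw_le hα (by positivity) ?_
      have := infDist_le_infDist_add_dist (s := E) (x := x) (y := y)
      linarith [Cube.dist_le hx hy]
    have h4 := rpow_neg_le_mul_rpow_neg (half_pos hD) (by norm_num : (1 : ℝ) ≤ 4) hα1
    rw [show 4 * (D / 2) = 2 * D by ring] at h4
    have h0 : 0 ≤ (2 * D) ^ (-α) := by positivity
    refine hav.trans (h4.trans ?_)
    refine mul_le_mul ?_ hess h0 (by positivity)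
    linarith [(by positivity : 0 ≤ 2 * n * A)]
  · push Not at hfar
    have hess := le_essInf_distw hα hpos fun y hy => Cube.infDist_le_mul_hole hy (hfar y hy)
    have hh := hhole P
    have h0 : 0 ≤ (2 * n * P.hole E) ^ (-α) := by positivity
    calc ⨍ y in P.set, distw E α y ≤ A * P.hole E ^ (-α) :=
          average_distw_le hα (by positivity) (h P)
      _ ≤ A * (2 * n * (2 * n * P.hole E) ^ (-α)) := by
        gcongr
        exact rpow_neg_le_mul_rpow_neg hh (by linarith) hα1
      _ = 2 * n * A * (2 * n * P.hole E) ^ (-α) := by ring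
      _ ≤ _ := mul_le_mul (by linarith) hess h0 (by positivity)

lemma exists_rpow_neg_mul_le {β p : ℝ} (hβ : 0 < β) (hp : 0 < p) :
    ∃ α : ℝ, 0 < α ∧ α < 1 ∧ β ^ (-α) * (1 - p) ≤ 1 - p / 2 := by
  have hcont : Filter.Tendsto (fun α : ℝ => β ^ (-α) * (1 - p)) (nhdsWithin 0 (Set.Ioi 0))
      (nhds (1 - p)) := by
    have : Continuous fun α : ℝ => β ^ (-α) * (1 - p) :=
      ((Real.continuous_const_rpow hβ.ne').comp continuous_neg).mul_const _
    simpa using (this.tendsto 0).mono_left nhdsWithin_le_nhds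
  obtain ⟨α, h1, h2⟩ := ((hcont.eventually_le_const (by linarith : 1 - p < 1 - p / 2)).and
    (Ioo_mem_nhdsGT (one_pos (α := ℝ)))).exists
  exact ⟨α, h2.1, h2.2, h1⟩

lemma not_weaklyPorousWith_zero {E : Set (EuclideanSpace ℝ (Fin 0))} {c δ : ℝ}
    (hE : E.Nonempty) (hc0 : 0 < c) : ¬ WeaklyPorousWith E c δ := by
  intro h
  obtain ⟨N, Q, hQ, -, -, hs⟩ := h ⟨0, 1, one_pos⟩
  rcases N with _ | N
  · simp [Cube.volume_set_toReal] at hs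
    linarith
  · obtain ⟨y, hy⟩ := hE
    exact (Set.mem_empty_iff_false y).1 ((hQ 0).2 ▸ ⟨fun i => i.elim0, hy⟩)

end Weight

/-- If `E` is weakly porous with constants `c, δ`, then there exist
`0 < α < 1` and `C`, depending only on `n, c, δ`, with `dist(·,E)^{-α} ∈ A₁`
with `A₁` constant at most `C`. -/
theorem weaklyPorous_implies_a1 (n : ℕ) (c δ : ℝ)
    (hc0 : 0 < c) (hc1 : c < 1) (hδ0 : 0 < δ) (hδ1 : δ < 1) :
    ∃ α C : ℝ, 0 < α ∧ α < 1 ∧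
      ∀ E : Set (EuclideanSpace ℝ (Fin n)), E.Nonempty → WeaklyPorousWith E c δ →
        IsWeight (distw E α) ∧ A1With (distw E α) C := by
  rcases eq_or_ne n 0 with rfl | hn
  · exact ⟨1 / 2, 0, by norm_num, by norm_num, fun E hE h =>
      absurd h (not_weaklyPorousWith_zero hE hc0)⟩
  have : NeZero n := ⟨hn⟩
  obtain ⟨κ, hκ, hκ1, hchild⟩ := WeaklyPorousWith.exists_hole_child n hc0 hc1 hδ0 hδ1
  have hp : 0 < c / 4 ^ n := by positivity
  obtain ⟨α, hα, hα1, hαp⟩ := exists_rpow_neg_mul_le (by positivity : 0 < κ * (δ / 16)) hp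
  set p := c / 4 ^ n
  set g := (κ * (δ / 16)) ^ (-α)
  have hg : 0 ≤ g := by positivity
  have hA : 0 ≤ 2 * g / p := by positivity
  have hαA : g * (1 + 2 * g / p * (1 - p)) ≤ 2 * g / p := by
    have h1 := mul_le_mul_of_nonneg_left hαp hA
    have h2 : 2 * g / p * (1 - p / 2) = 2 * g / p - g := by field_simp
    linarith
  refine ⟨α, 2 * n * (2 * g / p) + 4, hα, hα1, fun E hE h => ?_⟩
  have hint := h.lintegral_edistw_le hE hc0 hc1 hδ0 hδ1 hκ hκ1 (hchild E h) hα hA hαA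
  exact ⟨isWeight_distw hα fun P => ((hint P).trans_lt ENNReal.ofReal_lt_top).ne,
    a1With_distw hα hα1 hA (h.hole_pos hc0) hint⟩
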